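/- For integers r ≥ 2 and k_1, …, k_r ≥ 3, M_r(k_1,…,k_r) ≥ 3 · multinomial(k_1+⋯+k_r−2r; k_1−2, k_2−2, …, k_r−2). -/

import Mathlib

/-- Properties (i)–(iii) characterizing the main term `M_r` and the waste function `w_r`:
(i) `M_2(k₁,k₂) = C(k₁+k₂-2, k₁-1)` and `w_2(k₁,k₂) = 0`;
(ii) both functions "ignore 2's": if a coordinate of an `(r+1)`-tuple equals `2`, the value
equals that of the `r`-tuple with that coordinate removed;
(iii) if all coordinates are at least `3`, `M_r` satisfies the multinomial-type recurrence and
`w_r` satisfies the same recurrence with an extra additive `r - 2`. -/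
def MwProps (M w : ∀ r : ℕ, (Fin r → ℕ) → ℕ) : Prop :=
  (∀ k : Fin 2 → ℕ, (∀ i, 2 ≤ k i) →
      M 2 k = Nat.choose (k 0 + k 1 - 2) (k 0 - 1) ∧ w 2 k = 0) ∧
  (∀ r : ℕ, 2 ≤ r → ∀ k : Fin (r + 1) → ℕ, (∀ i, 2 ≤ k i) → ∀ i : Fin (r + 1), k i = 2 →
      M (r + 1) k = M r (k ∘ i.succAbove) ∧ w (r + 1) k = w r (k ∘ i.succAbove)) ∧
  (∀ r : ℕ, 2 ≤ r → ∀ k : Fin r → ℕ, (∀ i, 3 ≤ k i) →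
      M r k = ∑ i : Fin r, M r (Function.update k i (k i - 1)) ∧
      w r k = (∑ i : Fin r, w r (Function.update k i (k i - 1))) + (r - 2))

theorem Nat.multinomial_eq_sum_update {ι : Type*} [Fintype ι] [DecidableEq ι] [Nonempty ι]
    (a : ι → ℕ) (ha : ∀ i, 1 ≤ a i) :
    Nat.multinomial Finset.univ a =
      ∑ i, Nat.multinomial Finset.univ (Function.update a i (a i - 1)) := by
  have hpos : 0 < ∏ j, (a j).factorial := Finset.prod_pos fun j _ => Nat.factorial_pos _
  apply Nat.eq_of_mul_eq_mul_left hpos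
  rw [Nat.multinomial_spec, Finset.mul_sum]
  have hsum : 1 ≤ ∑ j, a j :=
    (ha (Classical.arbitrary ι)).trans (Finset.single_le_sum_of_canonicallyOrdered (by simp))
  have key : ∀ i, (∏ j, (a j).factorial) *
      Nat.multinomial Finset.univ (Function.update a i (a i - 1)) =
      a i * (∑ j, a j - 1).factorial := by
    intro i
    have hprod : ∏ j, (a j).factorial =
        a i * ∏ j, (Function.update a i (a i - 1) j).factorial := by
      rw [← Finset.mul_prod_erase Finset.univ _ (Finset.mem_univ i),
        ← Finset.mul_prod_erase Finset.univ
          (fun j => (Function.update a i (a i - 1) j).factorial) (Finset.mem_univ i),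
        ← mul_assoc]
      congr 1
      · simp only [Function.update_self]
        exact (Nat.mul_factorial_pred (by have := ha i; omega)).symm
      · refine Finset.prod_congr rfl fun j hj => ?_
        rw [Function.update_of_ne (Finset.ne_of_mem_erase hj)]
    have hs : ∑ j, Function.update a i (a i - 1) j = ∑ j, a j - 1 := by
      rw [Finset.sum_update_of_mem (Finset.mem_univ i), Finset.sdiff_singleton_eq_erase,
        ← Finset.add_sum_erase Finset.univ a (Finset.mem_univ i)]
      have := ha i
      omega
    rw [hprod, mul_assoc, Nat.multinomial_spec, hs]
  rw [Finset.sum_congr rfl fun i _ => key i, ← Finset.sum_mul,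
    Nat.mul_factorial_pred (by omega)]

theorem Nat.multinomial_comp_succAbove {n : ℕ} (a : Fin (n + 1) → ℕ) (i : Fin (n + 1))
    (hi : a i = 0) :
    Nat.multinomial Finset.univ (a ∘ i.succAbove) = Nat.multinomial Finset.univ a := by
  simp [Nat.multinomial, Fin.sum_univ_succAbove a i,
    Fin.prod_univ_succAbove (fun j => (a j).factorial) i, hi]

theorem Nat.choose_le_choose_succ_add_choose_pred (a b : ℕ) :
    (a + b + 2).choose (a + 1) ≤ (a + b + 2).choose a + (a + b + 2).choose (a + 2) := by
  have h₁ := Nat.choose_succ_right_eq (a + b + 2) a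
  have h₂ := Nat.choose_succ_right_eq (a + b + 2) (a + 1)
  rw [show a + b + 2 - a = b + 2 by omega] at h₁
  rw [show a + b + 2 - (a + 1) = b + 1 by omega, show a + 1 + 1 = a + 2 from rfl] at h₂
  rcases le_total a b with h | h
  · rcases h.eq_or_lt with rfl | h
    · nlinarith
    · nlinarith
  · rcases h.eq_or_lt with rfl | h
    · nlinarith
    · nlinarith

theorem Nat.three_mul_choose_le (a b : ℕ) :
    3 * (a + b + 2).choose (a + 1) ≤ (a + b + 4).choose (a + 2) := by
  have h := Nat.choose_le_choose_succ_add_choose_pred a b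
  have e₁ := Nat.choose_succ_succ (a + b + 3) (a + 1)
  have e₂ := Nat.choose_succ_succ (a + b + 2) a
  have e₃ := Nat.choose_succ_succ (a + b + 2) (a + 1)
  simp only [Nat.succ_eq_add_one, add_assoc, Nat.reduceAdd] at *
  omega

theorem stmt_11 (M w : ∀ r : ℕ, (Fin r → ℕ) → ℕ) (hMw : MwProps M w)
    (r : ℕ) (hr : 2 ≤ r) (k : Fin r → ℕ) (hk : ∀ i, 3 ≤ k i) :
    3 * Nat.multinomial Finset.univ (fun i => k i - 2) ≤ M r k := by
  obtain ⟨hbase, hremove, hrec⟩ := hMw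
  induction r, hr using Nat.le_induction with
  | base =>
    rw [(hbase k fun i => by have := hk i; omega).1]
    have hu : (Finset.univ : Finset (Fin 2)) = {0, 1} := rfl
    rw [hu, Nat.binomial_eq_choose (by decide)]
    obtain ⟨a, ha⟩ := Nat.exists_eq_add_of_le (hk 0)
    obtain ⟨b, hb⟩ := Nat.exists_eq_add_of_le (hk 1)
    convert Nat.three_mul_choose_le a b using 3 <;> omega
  | succ r hr ih =>
    induction hn : ∑ i, k i using Nat.strong_induction_on generalizing k with
    | _ n ihn =>
    rw [(hrec (r + 1) (by omega) k hk).1,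
      Nat.multinomial_eq_sum_update _ (fun i => by have := hk i; omega), Finset.mul_sum]
    refine Finset.sum_le_sum fun i _ => ?_
    have hupd : Function.update (fun j => k j - 2) i (k i - 2 - 1) =
        fun j => Function.update k i (k i - 1) j - 2 := by
      ext j
      rcases eq_or_ne j i with rfl | hj
      · simp only [Function.update_self]; omega
      · simp only [Function.update_of_ne hj]
    rw [hupd]
    have hne : ∀ j, j ≠ i → 3 ≤ Function.update k i (k i - 1) j := fun j hj => by
      rw [Function.update_of_ne hj]; exact hk j
    have hself : Function.update k i (k i - 1) i = k i - 1 := Function.update_self ..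
    have hki := hk i
    rcases hki.eq_or_lt with h3 | h3
    · have h2 : ∀ j, 2 ≤ Function.update k i (k i - 1) j := fun j => by
        rcases eq_or_ne j i with rfl | hj
        · omega
        · have := hne j hj; omega
      rw [(hremove r hr _ h2 i (by omega)).1,
        ← Nat.multinomial_comp_succAbove _ i (by omega)]
      exact ih _ fun j => hne _ (Fin.succAbove_ne i j)
    · refine ihn _ ?_ _ (fun j => ?_) rfl
      · rw [← hn]
        refine Finset.sum_lt_sum (fun j _ => ?_) ⟨i, Finset.mem_univ i, by omega⟩
        rcases eq_or_ne j i with rfl | hj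
        · omega
        · rw [Function.update_of_ne hj]
      · rcases eq_or_ne j i with rfl | hj
        · omega
        · exact hne j hj
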